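/- For any connected non-complete simple graph G of order n which is not a tree, ε(T_n) < ε(G) < ε(K_n), where ε(H) = n + P'(H, −1)/P(H, −1) for a graph H of order n; equivalently, (n−1)/2 < n + P'(G,−1)/P(G,−1) < n − ∑_{k=1}^{n} 1/k. -/

import Mathlib

open Polynomial

/-- `P` is the chromatic polynomial of `G`: for every natural number `k`,
`P` evaluated at `k` equals the number of proper `k`-colorings of `G`. -/
def IsChromPoly {W : Type*} (G : SimpleGraph W) (P : Polynomial ℝ) : Prop :=
  ∀ k : ℕ, P.eval (k : ℝ) = (Nat.card (G.Coloring (Fin k)) : ℝ)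

/-! ### Existence and uniqueness of the chromatic polynomial -/

theorem polynomial_eq_of_eval_natCast_eq {P Q : ℝ[X]}
    (h : ∀ k : ℕ, P.eval (k : ℝ) = Q.eval (k : ℝ)) : P = Q :=
  Polynomial.eq_of_infinite_eval_eq P Q <|
    (Set.infinite_range_of_injective (Nat.cast_injective (R := ℝ))).mono <| by
      rintro _ ⟨k, rfl⟩
      exact h k

theorem IsChromPoly.unique {W : Type*} {G : SimpleGraph W} {P Q : ℝ[X]}
    (hP : IsChromPoly G P) (hQ : IsChromPoly G Q) : P = Q :=
  polynomial_eq_of_eval_natCast_eq fun k => (hP k).trans (hQ k).symm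

namespace SimpleGraph

variable {V : Type*} {G : SimpleGraph V}

/-- The simple graph obtained from `G` by merging the vertex `v` into the vertex `u`. -/
def mergeVertex (G : SimpleGraph V) (u v : V) : SimpleGraph {x // x ≠ v} where
  Adj a b := a ≠ b ∧ (G.Adj a b ∨ (a.1 = u ∧ G.Adj v b) ∨ (b.1 = u ∧ G.Adj a v))
  symm.symm a b := by
    rintro ⟨h, h' | ⟨h', h''⟩ | ⟨h', h''⟩⟩
    · exact ⟨h.symm, Or.inl h'.symm⟩
    · exact ⟨h.symm, Or.inr (Or.inr ⟨h', h''.symm⟩)⟩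
    · exact ⟨h.symm, Or.inr (Or.inl ⟨h', h''.symm⟩)⟩
  loopless.irrefl a h := h.1 rfl

theorem Connected.mergeVertex (hG : G.Connected) {u v : V} (huv : u ≠ v) :
    (G.mergeVertex u v).Connected := by
  classical
  let f : V → {x // x ≠ v} := fun x => if h : x = v then ⟨u, huv⟩ else ⟨x, h⟩
  have hadj : ∀ a b, G.Adj a b → (G.mergeVertex u v).Reachable (f a) (f b) := by
    intro a b hab
    by_cases hf : f a = f b
    · rw [hf]
    · refine Adj.reachable ⟨hf, ?_⟩
      have := hab.ne
      by_cases ha : a = v <;> by_cases hb : b = v <;> simp_all [f]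
  have hreach : ∀ a b, G.Walk a b → (G.mergeVertex u v).Reachable (f a) (f b) := by
    intro a b p
    induction p with
    | nil => rfl
    | cons h _ ih => exact (hadj _ _ h).trans ih
  have hf : ∀ x : {x // x ≠ v}, f x = x := fun x => by simp [f, x.2]
  refine (connected_iff _).2 ⟨fun a b => ?_, ⟨⟨u, huv⟩⟩⟩
  obtain ⟨p⟩ := hG.preconnected a b
  simpa only [hf] using hreach _ _ p

/-- Proper colorings of `G` are the proper colorings of `G` minus an edge `uv` that
separate `u` and `v`. -/
def coloringDeleteEdgeEquivNe {u v : V} (huv : G.Adj u v) (α : Type*) :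
    {C : (G.deleteEdges {s(u, v)}).Coloring α // C u ≠ C v} ≃ G.Coloring α where
  toFun C := Coloring.mk C.1 fun {a b} hab => by
    by_cases h : s(a, b) = s(u, v)
    · rcases Sym2.eq_iff.1 h with ⟨rfl, rfl⟩ | ⟨rfl, rfl⟩
      · exact C.2
      · exact C.2.symm
    · exact C.1.valid (by simp [hab, h])
  invFun C := ⟨Coloring.mk C fun {a b} hab => C.valid (by
    rw [deleteEdges_adj] at hab; exact hab.1), C.valid huv⟩
  left_inv C := rfl
  right_inv C := rfl

open Classical in
/-- Proper colorings of the contraction `G / uv` are the proper colorings of `G` minus the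
edge `uv` that identify `u` and `v`. -/
noncomputable def coloringDeleteEdgeEquivEq {u v : V} (huv : G.Adj u v) (α : Type*) :
    {C : (G.deleteEdges {s(u, v)}).Coloring α // C u = C v} ≃ (G.mergeVertex u v).Coloring α where
  toFun C := Coloring.mk (fun x => C.1 x.1) fun {a b} hab => by
    obtain ⟨hne, h⟩ := hab
    have hne' : a.1 ≠ b.1 := fun h => hne (Subtype.ext h)
    rcases h with h | ⟨h, h'⟩ | ⟨h, h'⟩
    · exact C.1.valid (by simp [h, a.2, b.2])
    · rw [h, C.2]
      exact C.1.valid (by simp [h', b.2, ← h, hne'.symm])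
    · rw [h, C.2]
      exact C.1.valid (by simp [h', a.2, ← h, hne'])
  invFun C := ⟨Coloring.mk (fun x => if h : x = v then C ⟨u, huv.ne⟩ else C ⟨x, h⟩) (by
    intro a b hab
    rw [deleteEdges_adj] at hab
    obtain ⟨hab, hn⟩ := hab
    have hne := hab.ne
    by_cases ha : a = v
    · have hb : b ≠ v := fun hb => hne (ha.trans hb.symm)
      simp only [ha, hb, dite_true, dite_false]
      refine C.valid ⟨fun h => hn ?_, Or.inr (Or.inl ⟨rfl, ha ▸ hab⟩)⟩
      have : u = b := congrArg Subtype.val h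
      simp [ha, this, Sym2.eq_swap]
    · by_cases hb : b = v
      · simp only [ha, hb, dite_true, dite_false]
        refine C.valid ⟨fun h => hn ?_, Or.inr (Or.inr ⟨rfl, hb ▸ hab⟩)⟩
        have : a = u := congrArg Subtype.val h
        simp [hb, this]
      · simp only [ha, hb, dite_false]
        exact C.valid ⟨fun h => hne (congrArg Subtype.val h), Or.inl hab⟩), by
      change (if h : u = v then C ⟨u, huv.ne⟩ else C ⟨u, h⟩) =
        if h : v = v then C ⟨u, huv.ne⟩ else C ⟨v, h⟩
      simp [huv.ne]⟩
  left_inv C := by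
    refine Subtype.ext (RelHom.ext fun x => ?_)
    change (if h : x = v then C.1 u else C.1 x) = C.1 x
    split_ifs with h
    · rw [C.2, h]
    · rfl
  right_inv C := by
    refine RelHom.ext fun x => ?_
    change (if h : x.1 = v then C ⟨u, huv.ne⟩ else C ⟨x.1, h⟩) = C x
    simp [x.2]

theorem card_coloring_deleteEdges [Finite V] {u v : V} (huv : G.Adj u v)
    (α : Type*) [Finite α] :
    Nat.card ((G.deleteEdges {s(u, v)}).Coloring α) =
      Nat.card (G.Coloring α) + Nat.card ((G.mergeVertex u v).Coloring α) := by
  classical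
  have : Finite ((G.deleteEdges {s(u, v)}).Coloring α) := DFunLike.finite _
  rw [← Nat.card_congr (coloringDeleteEdgeEquivNe huv α),
    ← Nat.card_congr (coloringDeleteEdgeEquivEq huv α), add_comm, ← Nat.card_sum]
  exact Nat.card_congr
    (Equiv.sumCompl fun C : (G.deleteEdges {s(u, v)}).Coloring α => C u = C v).symm

theorem isChromPoly_bot [Fintype V] : IsChromPoly (⊥ : SimpleGraph V) (X ^ Fintype.card V) := by
  intro k
  have e : (⊥ : SimpleGraph V).Coloring (Fin k) ≃ (V → Fin k) :=
    { toFun := fun C => C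
      invFun := fun f => Coloring.mk f fun h => absurd h (by simp)
      left_inv := fun C => rfl
      right_inv := fun f => rfl }
  rw [Nat.card_congr e]
  simp [Nat.card_fun]

theorem _root_.IsChromPoly.of_deleteEdges [Finite V] {u v : V} (huv : G.Adj u v) {P Q : ℝ[X]}
    (hP : IsChromPoly (G.deleteEdges {s(u, v)}) P) (hQ : IsChromPoly (G.mergeVertex u v) Q) :
    IsChromPoly G (P - Q) := by
  intro k
  rw [eval_sub, hP, hQ, card_coloring_deleteEdges huv]
  push_cast
  ring

theorem deleteEdges_singleton_lt {u v : V} (huv : G.Adj u v) : G.deleteEdges {s(u, v)} < G := by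
  refine (deleteEdges_le _).lt_of_ne fun h => ?_
  rw [← h] at huv
  simp at huv

theorem card_subtype_ne [Fintype V] (v : V) [Fintype {x // x ≠ v}] :
    Fintype.card {x // x ≠ v} + 1 = Fintype.card V := by
  classical
  have := Fintype.card_pos_iff.2 ⟨v⟩
  have h := Fintype.card_subtype_compl (fun x => x = v)
  rw [Fintype.card_subtype_eq] at h
  have h' : Fintype.card {x // x ≠ v} = Fintype.card {x // ¬ x = v} := by convert rfl
  omega

theorem exists_isChromPoly {V : Type*} [Finite V] (G : SimpleGraph V) :
    ∃ P, IsChromPoly G P := by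
  classical
  have := Fintype.ofFinite V
  induction hn : Fintype.card V using Nat.strong_induction_on generalizing V with
  | _ n ihn =>
    induction G using WellFoundedLT.induction with
    | _ G ihG =>
      by_cases hG : G = ⊥
      · exact ⟨_, hG ▸ isChromPoly_bot⟩
      · obtain ⟨u, v, huv⟩ := ne_bot_iff_exists_adj.1 hG
        obtain ⟨P, hP⟩ := ihG _ (deleteEdges_singleton_lt huv)
        have hc := card_subtype_ne v
        obtain ⟨Q, hQ⟩ := ihn _ (by omega) (G.mergeVertex u v) inferInstance rfl
        exact ⟨_, hP.of_deleteEdges huv hQ⟩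

/-! ### The lower bound -/

theorem isChromPoly_of_subsingleton [Fintype V] (h : Fintype.card V = 1) : IsChromPoly G X := by
  have := Fintype.card_le_one_iff_subsingleton.1 h.le
  rw [Subsingleton.elim G ⊥]
  simpa [h] using isChromPoly_bot (V := V)

open Classical in
/-- Coloring a graph with a leaf `v` amounts to coloring the rest and choosing for `v` a color
different from that of its neighbour. -/
noncomputable def coloringLeafEquiv {u v : V} (huv : G.Adj v u) (hu : ∀ w, G.Adj v w → w = u)
    (α : Type*) :
    G.Coloring α ≃
      Σ C : (G.induce {v}ᶜ).Coloring α, {c : α // c ≠ C ⟨u, huv.ne.symm⟩} where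
  toFun C := ⟨Coloring.mk (fun x => C x.1) fun h => C.valid h, ⟨C v, C.valid huv⟩⟩
  invFun D := Coloring.mk (fun x => if h : x = v then D.2.1 else D.1 ⟨x, h⟩) (by
    intro a b hab
    have hne := hab.ne
    by_cases ha : a = v
    · have hb : b ≠ v := fun hb => hne (ha.trans hb.symm)
      subst ha
      have := hu b hab
      subst this
      simpa [hb] using D.2.2
    · by_cases hb : b = v
      · subst hb
        have := hu a hab.symm
        subst this
        simpa [ha] using D.2.2.symm
      · simp only [ha, hb, dite_false]
        exact D.1.valid hab)
  left_inv C := by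
    refine RelHom.ext fun x => ?_
    change (if h : x = v then C v else C x) = C x
    split_ifs with h
    · rw [h]
    · rfl
  right_inv D := by
    obtain ⟨C, c, hc⟩ := D
    have h1 : ∀ x : ({v}ᶜ : Set V), (if h : x.1 = v then c else C ⟨x.1, h⟩) = C x := fun x => by
      have : x.1 ≠ v := x.2
      simp [this]
    refine Sigma.ext (RelHom.ext h1) ?_
    refine (Subtype.heq_iff_coe_eq ?_).2 ?_
    · intro x
      exact Iff.of_eq (congrArg (x ≠ ·) (h1 _))
    · change (if h : v = v then c else C ⟨v, h⟩) = c
      simp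

theorem _root_.IsChromPoly.of_leaf [Finite V] {u v : V} (huv : G.Adj v u)
    (hu : ∀ w, G.Adj v w → w = u) {P : ℝ[X]} (hP : IsChromPoly (G.induce {v}ᶜ) P) :
    IsChromPoly G ((X - 1) * P) := by
  classical
  intro k
  have : Finite ((G.induce {v}ᶜ).Coloring (Fin k)) := DFunLike.finite _
  have := Fintype.ofFinite ((G.induce {v}ᶜ).Coloring (Fin k))
  rw [Nat.card_congr (coloringLeafEquiv huv hu (Fin k)), Nat.card_sigma, eval_mul, hP]
  rcases k.eq_zero_or_pos with rfl | hk
  · have : IsEmpty ((G.induce {v}ᶜ).Coloring (Fin 0)) :=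
      ⟨fun C => (C ⟨u, huv.ne.symm⟩).elim0⟩
    simp
  · have h : ∀ c : Fin k, Nat.card {x // x ≠ c} = k - 1 := fun c => by
      have := card_subtype_ne c
      simp only [Fintype.card_fin] at this
      rw [Nat.card_eq_fintype_card]
      omega
    simp only [h, Finset.sum_const, Finset.card_univ, smul_eq_mul, Nat.card_eq_fintype_card]
    push_cast [Nat.cast_sub hk]
    simp [mul_comm]

theorem Connected.chromPoly_lower_bound {V : Type*} [Fintype V] {G : SimpleGraph V}
    (hG : G.Connected) {P : ℝ[X]} (hP : IsChromPoly G P) :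
    0 < (-1) ^ Fintype.card V * P.eval (-1) ∧
    2 * ((-1) ^ (Fintype.card V + 1) * (derivative P).eval (-1)) ≤
      (Fintype.card V + 1) * ((-1) ^ Fintype.card V * P.eval (-1)) ∧
    (¬ G.IsAcyclic → 2 * ((-1) ^ (Fintype.card V + 1) * (derivative P).eval (-1)) <
      (Fintype.card V + 1) * ((-1) ^ Fintype.card V * P.eval (-1))) := by
  classical
  induction hn : Fintype.card V using Nat.strong_induction_on generalizing V P with
  | _ n ihn =>
    induction G using WellFoundedLT.induction generalizing P with
    | _ G ihG =>
      have hpos : 0 < n := hn ▸ Fintype.card_pos_iff.2 hG.nonempty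
      obtain ⟨m, rfl⟩ := Nat.exists_eq_add_of_le' hpos
      by_cases hac : G.IsAcyclic
      · simp only [hac, not_true_eq_false, false_imp_iff, and_true]
        rcases Nat.eq_zero_or_pos m with rfl | hm
        · rw [hP.unique (isChromPoly_of_subsingleton hn)]
          norm_num
        · have : Nontrivial V := Fintype.one_lt_card_iff_nontrivial.1 (by omega)
          obtain ⟨v, hv⟩ := (IsTree.mk hG hac).exists_vert_degree_one_of_nontrivial
          have hcon := hG.induce_compl_singleton_of_degree_eq_one hv
          obtain ⟨u, huv, hu⟩ := degree_eq_one_iff_existsUnique_adj.1 hv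
          obtain ⟨Q, hQ⟩ := (G.induce {v}ᶜ).exists_isChromPoly
          have hc : Fintype.card ({v}ᶜ : Set V) = m := by
            have := card_subtype_ne v
            have h' : Fintype.card ({v}ᶜ : Set V) = Fintype.card {x // x ≠ v} :=
              Fintype.card_congr (Equiv.refl _)
            omega
          obtain ⟨h1, h2, -⟩ := ihn m (by omega) hcon hQ hc
          rw [hP.unique (hQ.of_leaf huv hu)]
          simp only [derivative_mul, derivative_sub, derivative_X, derivative_one, eval_add,
            eval_mul, eval_sub, eval_X, eval_one, eval_zero, pow_succ] at h1 h2 ⊢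
          push_cast
          constructor <;> linarith
      · simp only [hac, not_false_eq_true, true_imp_iff]
        rw [isAcyclic_iff_forall_adj_isBridge] at hac
        push Not at hac
        obtain ⟨u, v, huv, hb⟩ := hac
        obtain ⟨P₁, hP₁⟩ := (G.deleteEdges {s(u, v)}).exists_isChromPoly
        obtain ⟨P₂, hP₂⟩ := (G.mergeVertex u v).exists_isChromPoly
        have hc := card_subtype_ne v
        obtain ⟨h1, h2, -⟩ := ihG _ (deleteEdges_singleton_lt huv)
          (hG.connected_delete_edge_of_not_isBridge hb) hP₁
        obtain ⟨h3, h4, -⟩ := ihn m (by omega) (hG.mergeVertex huv.ne) hP₂ (by omega)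
        rw [hP.unique (hP₁.of_deleteEdges huv hP₂)]
        simp only [derivative_sub, eval_sub, pow_succ] at h1 h2 h3 h4 ⊢
        push_cast at h1 h2 h3 h4 ⊢
        refine ⟨?_, ?_, ?_⟩ <;> linarith

end SimpleGraph
/-! ### Colorings of vertex subsets -/

namespace SimpleGraph

open Finset Classical

variable {V : Type*} [Fintype V] (G : SimpleGraph V)

/-- The proper colorings of `G` restricted to `T` with colors `1, …, k`, extended by `0`
outside of `T`. -/
noncomputable def colorFuns (T : Finset V) (k : ℕ) : Finset (V → ℕ) :=
  {c ∈ Fintype.piFinset fun x => if x ∈ T then Icc 1 k else {0} |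
    ∀ a ∈ T, ∀ b ∈ T, G.Adj a b → c a ≠ c b}

/-- The chromatic polynomial of the subgraph of `G` induced by `T`. -/
noncomputable def chromPolyOn (T : Finset V) : ℝ[X] :=
  (G.induce (T : Set V)).exists_isChromPoly.choose

variable {G}

theorem mem_colorFuns {T : Finset V} {k : ℕ} {c : V → ℕ} :
    c ∈ G.colorFuns T k ↔ (∀ x ∈ T, 1 ≤ c x ∧ c x ≤ k) ∧ (∀ x ∉ T, c x = 0) ∧
      ∀ a ∈ T, ∀ b ∈ T, G.Adj a b → c a ≠ c b := by
  simp only [colorFuns, mem_filter, Fintype.mem_piFinset, ← and_assoc]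
  refine and_congr_left fun _ => ⟨fun h => ⟨fun x hx => ?_, fun x hx => ?_⟩, fun h x => ?_⟩
  · simpa [hx] using h x
  · simpa [hx] using h x
  · by_cases hx : x ∈ T
    · simpa [hx] using h.1 x hx
    · simpa [hx] using h.2 x hx

theorem card_coloring_induce (T : Finset V) (k : ℕ) :
    Nat.card ((G.induce (T : Set V)).Coloring (Fin k)) = #(G.colorFuns T k) := by
  rw [← Fintype.card_coe, ← Nat.card_eq_fintype_card]
  refine Nat.card_congr
    { toFun := fun C => ⟨fun x => if h : x ∈ T then (C ⟨x, h⟩ : ℕ) + 1 else 0, ?_⟩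
      invFun := fun c => Coloring.mk
        (fun x => ⟨c.1 x.1 - 1, by have := (mem_colorFuns.1 c.2).1 x.1 x.2; omega⟩) ?_
      left_inv := fun C => ?_
      right_inv := fun c => ?_ }
  · refine mem_colorFuns.2 ⟨fun x hx => ?_, fun x hx => by simp [hx], fun a ha b hb hab => ?_⟩
    · have := (C ⟨x, hx⟩).2
      simp only [hx, dite_true]
      omega
    · have : C ⟨a, ha⟩ ≠ C ⟨b, hb⟩ := C.valid hab
      simpa [ha, hb, Fin.ext_iff] using this
  · intro a b hab h
    have h1 := (mem_colorFuns.1 c.2).1 a.1 a.2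
    have h2 := (mem_colorFuns.1 c.2).1 b.1 b.2
    have h3 := (mem_colorFuns.1 c.2).2.2 a.1 a.2 b.1 b.2 hab
    simp only [Fin.mk.injEq] at h
    omega
  · refine RelHom.ext fun x => Fin.ext ?_
    have hx : x.1 ∈ T := x.2
    change (if h : x.1 ∈ T then (C ⟨x.1, h⟩ : ℕ) + 1 else 0) - 1 = C x
    simp [hx]
  · refine Subtype.ext (funext fun x => ?_)
    change (if x ∈ T then (c.1 x - 1) + 1 else 0) = c.1 x
    split_ifs with hx
    · have := (mem_colorFuns.1 c.2).1 x hx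
      omega
    · exact ((mem_colorFuns.1 c.2).2.1 x hx).symm

theorem eval_chromPolyOn (T : Finset V) (k : ℕ) :
    (G.chromPolyOn T).eval (k : ℝ) = #(G.colorFuns T k) := by
  rw [← card_coloring_induce]
  exact (G.induce (T : Set V)).exists_isChromPoly.choose_spec k

theorem isChromPoly_chromPolyOn_univ : IsChromPoly G (G.chromPolyOn univ) := by
  intro k
  rw [eval_chromPolyOn, ← card_coloring_induce]
  refine congrArg Nat.cast (Nat.card_congr
    { toFun := fun C => Coloring.mk (fun x => C ⟨x, by simp⟩) fun {a b} h => C.valid h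
      invFun := fun C => Coloring.mk (fun x => C x.1) fun {a b} h => C.valid h
      left_inv := fun C => rfl
      right_inv := fun C => rfl })

theorem card_colorFuns_filter_eq {S T : Finset V} (hST : S ⊆ T) (k l : ℕ) :
    #{c ∈ G.colorFuns T (k + l) | {x ∈ T | c x ≤ k} = S} =
      #(G.colorFuns S k) * #(G.colorFuns (T \ S) l) := by
  rw [← card_product]
  refine card_nbij' (fun c => (fun x => if x ∈ S then c x else 0,
      fun x => if x ∈ S then 0 else c x - k))
    (fun d x => if x ∈ S then d.1 x else if x ∈ T then d.2 x + k else 0) ?_ ?_ ?_ ?_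
  · intro c hc
    simp only [mem_coe, mem_filter, mem_colorFuns, mem_product, Finset.ext_iff] at hc ⊢
    grind
  · intro d hd
    simp only [mem_coe, mem_filter, mem_colorFuns, mem_product, Finset.ext_iff] at hd ⊢
    grind
  · intro c hc
    simp only [mem_coe, mem_filter, mem_colorFuns, Finset.ext_iff] at hc
    funext x
    grind
  · intro d hd
    simp only [mem_coe, mem_colorFuns, mem_product] at hd
    refine Prod.ext (funext fun x => ?_) (funext fun x => ?_) <;> grind

theorem card_colorFuns_add (T : Finset V) (k l : ℕ) :
    #(G.colorFuns T (k + l)) =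
      ∑ S ∈ T.powerset, #(G.colorFuns S k) * #(G.colorFuns (T \ S) l) := by
  rw [card_eq_sum_card_fiberwise (f := fun c => {x ∈ T | c x ≤ k}) (t := T.powerset)
    fun c _ => mem_coe.2 (mem_powerset.2 (filter_subset _ _))]
  exact sum_congr rfl fun S hS => card_colorFuns_filter_eq (mem_powerset.1 hS) k l

theorem card_colorFuns_filter_le {v : V} {T : Finset V} (hv : v ∈ T) (k l : ℕ) :
    #{c ∈ G.colorFuns T (k + l) | c v ≤ k} =
      ∑ S ∈ T.powerset with v ∈ S, #(G.colorFuns S k) * #(G.colorFuns (T \ S) l) := by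
  rw [card_eq_sum_card_fiberwise (f := fun c => {x ∈ T | c x ≤ k})
    (t := {S ∈ T.powerset | v ∈ S}) fun c hc => by simp_all [filter_subset]]
  refine sum_congr rfl fun S hS => ?_
  rw [mem_filter, mem_powerset] at hS
  rw [← card_colorFuns_filter_eq hS.1, filter_filter]
  refine congrArg _ (filter_congr fun c _ => and_iff_right_of_imp ?_)
  rintro rfl
  exact (mem_filter.1 hS.2).2

theorem card_colorFuns_filter_apply_eq {v : V} {T : Finset V} {m i : ℕ}
    (hi : i ∈ Icc 1 m) :
    #{c ∈ G.colorFuns T m | c v = i} = #{c ∈ G.colorFuns T m | c v = 1} := by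
  rw [mem_Icc] at hi
  have key : ∀ c ∈ G.colorFuns T m, Equiv.swap i 1 ∘ c ∈ G.colorFuns T m := by
    intro c hc
    rw [mem_colorFuns] at hc ⊢
    refine ⟨fun x hx => ?_, fun x hx => ?_, fun a ha b hb hab => ?_⟩
    · have := hc.1 x hx
      simp only [Function.comp_apply, Equiv.swap_apply_def]
      split_ifs <;> omega
    · rw [Function.comp_apply, hc.2.1 x hx]
      exact Equiv.swap_apply_of_ne_of_ne (by omega) (by omega)
    · exact (Equiv.injective _).ne (hc.2.2 a ha b hb hab)
  refine card_nbij' (Equiv.swap i 1 ∘ ·) (Equiv.swap i 1 ∘ ·) ?_ ?_ ?_ ?_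
  · intro c hc
    simp only [coe_filter, Set.mem_ofPred_eq] at hc ⊢
    exact ⟨key c hc.1, by simp [hc.2]⟩
  · intro c hc
    simp only [coe_filter, Set.mem_ofPred_eq] at hc ⊢
    exact ⟨key c hc.1, by simp [hc.2]⟩
  · intro c _
    funext x
    simp
  · intro c _
    funext x
    simp

/-- The fraction of colorings with `k + l` colors giving `v` one of the first `k` colors is
`k / (k + l)`. -/
theorem add_mul_sum_card_colorFuns {v : V} {T : Finset V} (hv : v ∈ T) (k l : ℕ) :
    (k + l) * ∑ S ∈ T.powerset with v ∈ S, #(G.colorFuns S k) * #(G.colorFuns (T \ S) l) =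
      k * #(G.colorFuns T (k + l)) := by
  have h : ∀ j ≤ k + l, #{c ∈ G.colorFuns T (k + l) | c v ≤ j} =
      j * #{c ∈ G.colorFuns T (k + l) | c v = 1} := by
    intro j hj
    rw [card_eq_sum_card_fiberwise (f := fun c => c v) (t := Icc 1 j) fun c hc => by
      simp only [coe_filter, Set.mem_ofPred_eq, mem_colorFuns] at hc
      simpa using ⟨(hc.1.1 v hv).1, hc.2⟩]
    rw [sum_congr rfl fun i hi => ?_, sum_const, Nat.card_Icc, smul_eq_mul, Nat.add_sub_cancel]
    rw [mem_Icc] at hi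
    rw [filter_filter, ← card_colorFuns_filter_apply_eq (i := i) (mem_Icc.2 ⟨hi.1, by omega⟩)]
    refine congrArg _ (filter_congr fun c _ => ?_)
    omega
  have h' : #(G.colorFuns T (k + l)) = (k + l) * #{c ∈ G.colorFuns T (k + l) | c v = 1} := by
    rw [← h _ le_rfl]
    refine congrArg _ (filter_true_of_mem fun c hc => ?_).symm
    exact ((mem_colorFuns.1 hc).1 v hv).2
  rw [← card_colorFuns_filter_le hv, h k (by omega), h']
  ring

/-! ### Convolution identities for chromatic polynomials -/

theorem comp_chromPolyOn (T : Finset V) (y : ℝ) :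
    (G.chromPolyOn T).comp (X + C y) =
      ∑ S ∈ T.powerset, G.chromPolyOn S * C ((G.chromPolyOn (T \ S)).eval y) := by
  refine polynomial_eq_of_eval_natCast_eq fun k => ?_
  have h : (G.chromPolyOn T).comp (C (k : ℝ) + X) =
      ∑ S ∈ T.powerset, C ((G.chromPolyOn S).eval (k : ℝ)) * G.chromPolyOn (T \ S) := by
    refine polynomial_eq_of_eval_natCast_eq fun l => ?_
    simp only [eval_comp, eval_add, eval_C, eval_X, eval_finsetSum, eval_mul, eval_chromPolyOn,
      ← Nat.cast_add, card_colorFuns_add, Nat.cast_sum, Nat.cast_mul]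
  simpa [eval_finsetSum] using congrArg (eval y) h

theorem mul_sum_chromPolyOn {v : V} {T : Finset V} (hv : v ∈ T) (y : ℝ) :
    (X + C y) * ∑ S ∈ T.powerset with v ∈ S,
        G.chromPolyOn S * C ((G.chromPolyOn (T \ S)).eval y) =
      X * (G.chromPolyOn T).comp (X + C y) := by
  refine polynomial_eq_of_eval_natCast_eq fun k => ?_
  have h : (C (k : ℝ) + X) * ∑ S ∈ T.powerset with v ∈ S,
        C ((G.chromPolyOn S).eval (k : ℝ)) * G.chromPolyOn (T \ S) =
      C (k : ℝ) * (G.chromPolyOn T).comp (C (k : ℝ) + X) := by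
    refine polynomial_eq_of_eval_natCast_eq fun l => ?_
    simp only [eval_comp, eval_add, eval_C, eval_X, eval_finsetSum, eval_mul, eval_chromPolyOn,
      ← Nat.cast_add]
    exact_mod_cast add_mul_sum_card_colorFuns hv k l
  simpa [eval_finsetSum] using congrArg (eval y) h

theorem eval_zero_chromPolyOn {T : Finset V} (hT : T.Nonempty) :
    (G.chromPolyOn T).eval 0 = 0 := by
  obtain ⟨v, hv⟩ := hT
  rw [← Nat.cast_zero, eval_chromPolyOn, Nat.cast_inj, card_eq_zero,
    eq_empty_iff_forall_notMem]
  intro c hc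
  have := (mem_colorFuns.1 hc).1 v hv
  omega

theorem chromPolyOn_empty : G.chromPolyOn (∅ : Finset V) = 1 := by
  refine polynomial_eq_of_eval_natCast_eq fun k => ?_
  rw [eval_chromPolyOn, eval_one, ← Nat.cast_one, Nat.cast_inj, card_eq_one]
  refine ⟨0, ?_⟩
  ext c
  simp [mem_colorFuns, funext_iff]

theorem eval_one_chromPolyOn (T : Finset V) :
    (G.chromPolyOn T).eval 1 = if ∀ a ∈ T, ∀ b ∈ T, ¬ G.Adj a b then 1 else 0 := by
  rw [← Nat.cast_one, eval_chromPolyOn]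
  split_ifs with h
  · rw [Nat.cast_inj, card_eq_one]
    refine ⟨fun x => if x ∈ T then 1 else 0, ?_⟩
    ext c
    rw [mem_colorFuns, mem_singleton]
    refine ⟨fun hc => funext fun x => ?_, ?_⟩
    · have h1 := hc.1 x
      have h2 := hc.2.1 x
      split_ifs with hx
      · have := h1 hx
        omega
      · exact h2 hx
    · rintro rfl
      exact ⟨fun x hx => by simp [hx], fun x hx => by simp [hx],
        fun a ha b hb hab => absurd hab (h a ha b hb)⟩
  · push Not at h
    obtain ⟨a, ha, b, hb, hab⟩ := h
    rw [Nat.cast_eq_zero, card_eq_zero, eq_empty_iff_forall_notMem]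
    intro c hc
    have h1 := (mem_colorFuns.1 hc).1 a ha
    have h2 := (mem_colorFuns.1 hc).1 b hb
    have h3 := (mem_colorFuns.1 hc).2.2 a ha b hb hab
    omega

theorem eval_derivative_chromPolyOn (T : Finset V) (y : ℝ) :
    (derivative (G.chromPolyOn T)).eval y =
      ∑ S ∈ T.powerset,
        (derivative (G.chromPolyOn S)).eval 0 * (G.chromPolyOn (T \ S)).eval y := by
  have h := congrArg (fun p => (derivative p).eval 0) (comp_chromPolyOn (G := G) T y)
  simpa [derivative_comp, derivative_sum, eval_finsetSum] using h

theorem eval_chromPolyOn_eq_mul_sum {v : V} {T : Finset V} (hv : v ∈ T) (y : ℝ) :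
    (G.chromPolyOn T).eval y =
      y * ∑ S ∈ T.powerset with v ∈ S,
        (derivative (G.chromPolyOn S)).eval 0 * (G.chromPolyOn (T \ S)).eval y := by
  have h := congrArg (fun p => (derivative p).eval 0) (mul_sum_chromPolyOn (G := G) hv y)
  have h0 : ∑ S ∈ T.powerset with v ∈ S,
      (G.chromPolyOn S).eval 0 * (G.chromPolyOn (T \ S)).eval y = 0 :=
    sum_eq_zero fun S hS => by
      rw [eval_zero_chromPolyOn ⟨v, (mem_filter.1 hS).2⟩, zero_mul]
  simpa [derivative_mul, derivative_sum, eval_finsetSum, h0] using h.symm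

end SimpleGraph
/-! ### Acyclic orientations -/

namespace SimpleGraph

open Finset Classical

variable {V : Type*} [Fintype V] (G : SimpleGraph V)

/-- The acyclic orientations of the subgraph of `G` induced by `T`, i.e. the orientations
directing each edge towards its endpoint of larger height, for some height function. -/
noncomputable def acyclicOrientations (T : Finset V) : Finset (V → V → Prop) :=
  {r | ∃ f : V → ℕ, (∀ a ∈ T, ∀ b ∈ T, G.Adj a b → f a ≠ f b) ∧
    ∀ a b, r a b ↔ a ∈ T ∧ b ∈ T ∧ G.Adj a b ∧ f a < f b}

/-- The vertices from which `v` can be reached along `r`. -/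
noncomputable def ancestors (r : V → V → Prop) (v : V) : Finset V :=
  {u | Relation.ReflTransGen r u v}

variable {G}

theorem mem_acyclicOrientations {T : Finset V} {r : V → V → Prop} :
    r ∈ G.acyclicOrientations T ↔
      ∃ f : V → ℕ, (∀ a ∈ T, ∀ b ∈ T, G.Adj a b → f a ≠ f b) ∧
        ∀ a b, r a b ↔ a ∈ T ∧ b ∈ T ∧ G.Adj a b ∧ f a < f b := by
  simp [acyclicOrientations]

theorem mem_ancestors {r : V → V → Prop} {u v : V} :
    u ∈ ancestors r v ↔ Relation.ReflTransGen r u v := by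
  simp [ancestors]

theorem self_mem_ancestors (r : V → V → Prop) (v : V) : v ∈ ancestors r v :=
  mem_ancestors.2 .refl

theorem ancestors_subset {r : V → V → Prop} {S : Finset V} {v : V} (hv : v ∈ S)
    (hS : ∀ a, ∀ b ∈ S, r a b → a ∈ S) : ancestors r v ⊆ S := by
  intro u hu
  induction mem_ancestors.1 hu using Relation.ReflTransGen.head_induction_on with
  | refl => exact hv
  | head h h' ih => exact hS _ _ (ih (mem_ancestors.2 h')) h

theorem mem_of_rel_of_mem_acyclicOrientations {T : Finset V} {r : V → V → Prop}
    (hr : r ∈ G.acyclicOrientations T) {a b : V} (h : r a b) : a ∈ T ∧ b ∈ T := by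
  obtain ⟨f, -, hf⟩ := mem_acyclicOrientations.1 hr
  exact ⟨((hf a b).1 h).1, ((hf a b).1 h).2.1⟩

/-- An acyclic orientation of `T` for which no edge enters `S` amounts to acyclic orientations
of `S` and of `T \ S`. -/
theorem card_acyclicOrientations_filter {S T : Finset V} (hST : S ⊆ T)
    (q : (V → V → Prop) → Prop) [DecidablePred q] :
    #{r ∈ G.acyclicOrientations T | (∀ a ∈ T \ S, ∀ b ∈ S, ¬ r a b) ∧
        q fun a b => a ∈ S ∧ b ∈ S ∧ r a b} =
      #{r ∈ G.acyclicOrientations S | q r} * #(G.acyclicOrientations (T \ S)) := by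
  rw [← card_product]
  refine card_nbij' (fun r => (fun a b => a ∈ S ∧ b ∈ S ∧ r a b,
      fun a b => a ∈ T \ S ∧ b ∈ T \ S ∧ r a b))
    (fun d a b => d.1 a b ∨ d.2 a b ∨ (a ∈ S ∧ b ∈ T \ S ∧ G.Adj a b)) ?_ ?_ ?_ ?_
  · intro r hr
    simp only [coe_filter, Set.mem_ofPred_eq, coe_product, Set.mem_prod, mem_coe] at hr ⊢
    obtain ⟨hr, -, hq⟩ := hr
    obtain ⟨f, hf, hrf⟩ := mem_acyclicOrientations.1 hr
    refine ⟨⟨mem_acyclicOrientations.2 ⟨f, fun a ha b hb => hf a (hST ha) b (hST hb),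
      fun a b => ?_⟩, hq⟩, mem_acyclicOrientations.2 ⟨f, fun a ha b hb =>
        hf a (mem_sdiff.1 ha).1 b (mem_sdiff.1 hb).1, fun a b => ?_⟩⟩
    · rw [hrf]
      grind
    · rw [hrf]
      grind
  · rintro ⟨r₁, r₂⟩ hr
    simp only [coe_filter, Set.mem_ofPred_eq, coe_product, Set.mem_prod, mem_coe] at hr ⊢
    obtain ⟨⟨h₁, hq⟩, h₂⟩ := hr
    obtain ⟨f₁, hf₁, hr₁⟩ := mem_acyclicOrientations.1 h₁
    obtain ⟨f₂, hf₂, hr₂⟩ := mem_acyclicOrientations.1 h₂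
    have hM : ∀ x, f₁ x < univ.sup f₁ + 1 := fun x =>
      Nat.lt_succ_of_le (le_sup (f := f₁) (mem_univ x))
    refine ⟨mem_acyclicOrientations.2
      ⟨fun x => if x ∈ S then f₁ x else univ.sup f₁ + 1 + f₂ x, fun a ha b hb hab => ?_,
        fun a b => ?_⟩, fun a ha b hb => ?_, ?_⟩
    · have := hM a
      have := hM b
      grind
    · have := hM a
      have := hM b
      rw [hr₁, hr₂]
      grind
    · rw [hr₁, hr₂]
      grind
    · convert hq using 1
      funext a b
      rw [hr₁, hr₂]
      grind
  · intro r hr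
    simp only [coe_filter, Set.mem_ofPred_eq] at hr
    obtain ⟨hr, hn, -⟩ := hr
    obtain ⟨f, hf, hrf⟩ := mem_acyclicOrientations.1 hr
    funext a b
    have h1 := hrf a b
    have h2 := hrf b a
    have h3 := hf a
    have h4 := hn b
    have h5 : G.Adj a b ↔ G.Adj b a := G.adj_comm a b
    grind
  · rintro ⟨r₁, r₂⟩ hr
    simp only [coe_filter, Set.mem_ofPred_eq, coe_product, Set.mem_prod, mem_coe] at hr
    have h₁ := fun a b => mem_of_rel_of_mem_acyclicOrientations hr.1.1 (a := a) (b := b)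
    have h₂ := fun a b => mem_of_rel_of_mem_acyclicOrientations hr.2 (a := a) (b := b)
    refine Prod.ext (funext fun a => funext fun b => ?_) (funext fun a => funext fun b => ?_)
    · have := h₁ a b
      have := h₂ a b
      grind
    · have := h₁ a b
      have := h₂ a b
      grind

theorem ancestors_eq_iff {S T : Finset V} {r : V → V → Prop}
    (hr : r ∈ G.acyclicOrientations T) {v : V} (hv : v ∈ S) :
    ancestors r v = S ↔ (∀ a ∈ T \ S, ∀ b ∈ S, ¬ r a b) ∧
      ancestors (fun a b => a ∈ S ∧ b ∈ S ∧ r a b) v = S := by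
  have hmono : ancestors (fun a b => a ∈ S ∧ b ∈ S ∧ r a b) v ⊆ ancestors r v := fun u hu =>
    mem_ancestors.2 ((mem_ancestors.1 hu).lift id fun _ _ h => h.2.2)
  refine ⟨fun h => ?_, fun ⟨h1, h2⟩ => ?_⟩
  · have hcl : ∀ a, ∀ b ∈ S, r a b → a ∈ S := fun a b hb hab => by
      rw [← h, mem_ancestors] at hb ⊢
      exact .head hab hb
    refine ⟨fun a ha b hb hab => (mem_sdiff.1 ha).2 (hcl a b hb hab),
      Subset.antisymm (hmono.trans h.subset) fun u hu => ?_⟩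
    rw [← h, mem_ancestors] at hu
    suffices u ∈ S ∧ u ∈ ancestors (fun a b => a ∈ S ∧ b ∈ S ∧ r a b) v from this.2
    induction hu using Relation.ReflTransGen.head_induction_on with
    | refl => exact ⟨hv, self_mem_ancestors _ _⟩
    | @head a b hab _ ih =>
      have ha := hcl _ _ ih.1 hab
      exact ⟨ha, mem_ancestors.2 (.head ⟨ha, ih.1, hab⟩ (mem_ancestors.1 ih.2))⟩
  · refine Subset.antisymm (ancestors_subset hv fun a b hb hab => ?_) (h2.symm.subset.trans hmono)
    by_contra ha
    exact h1 a (mem_sdiff.2 ⟨(mem_of_rel_of_mem_acyclicOrientations hr hab).1, ha⟩) b hb hab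

theorem card_acyclicOrientations_ancestors_eq {S T : Finset V} (hST : S ⊆ T) {v : V}
    (hv : v ∈ S) :
    #{r ∈ G.acyclicOrientations T | ancestors r v = S} =
      #{r ∈ G.acyclicOrientations S | ancestors r v = S} * #(G.acyclicOrientations (T \ S)) := by
  rw [← card_acyclicOrientations_filter hST fun r => ancestors r v = S]
  exact congrArg _ (filter_congr fun r hr => ancestors_eq_iff hr hv)

theorem ancestors_mem_powerset {T : Finset V} {r : V → V → Prop}
    (hr : r ∈ G.acyclicOrientations T) {v : V} (hv : v ∈ T) :
    ancestors r v ∈ T.powerset.filter (v ∈ ·) :=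
  mem_filter.2 ⟨mem_powerset.2 <| ancestors_subset hv fun _ _ _ h =>
    (mem_of_rel_of_mem_acyclicOrientations hr h).1, self_mem_ancestors r v⟩

theorem card_acyclicOrientations_eq_sum {T : Finset V} {v : V} (hv : v ∈ T) :
    #(G.acyclicOrientations T) = ∑ S ∈ T.powerset with v ∈ S,
      #{r ∈ G.acyclicOrientations S | ancestors r v = S} * #(G.acyclicOrientations (T \ S)) := by
  rw [card_eq_sum_card_fiberwise (f := fun r => ancestors r v) (t := T.powerset.filter (v ∈ ·))
    fun r hr => ancestors_mem_powerset hr hv]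
  refine sum_congr rfl fun S hS => ?_
  rw [mem_filter, mem_powerset] at hS
  exact card_acyclicOrientations_ancestors_eq hS.1 hS.2

theorem card_acyclicOrientations_of_indep {T : Finset V} (hT : ∀ a ∈ T, ∀ b ∈ T, ¬ G.Adj a b) :
    #(G.acyclicOrientations T) = 1 := by
  rw [card_eq_one]
  refine ⟨fun _ _ => False, ?_⟩
  ext r
  rw [mem_acyclicOrientations, mem_singleton]
  refine ⟨fun ⟨f, _, hf⟩ => ?_, ?_⟩
  · funext a b
    have := hf a b
    have := hT a
    grind
  · rintro rfl
    exact ⟨0, fun a ha b hb hab => absurd hab (hT a ha b hb), by simp⟩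

theorem card_acyclicOrientations_sinks {I T : Finset V} (hI : I ⊆ T) :
    #{r ∈ G.acyclicOrientations T | ∀ a ∈ I, ∀ b, ¬ r a b} =
      if ∀ a ∈ I, ∀ b ∈ I, ¬ G.Adj a b then #(G.acyclicOrientations (T \ I)) else 0 := by
  split_ifs with h
  · have h1 := card_acyclicOrientations_filter (G := G) (sdiff_subset : T \ I ⊆ T) fun _ => True
    rw [Finset.sdiff_sdiff_eq_self hI, card_acyclicOrientations_of_indep h, mul_one, filter_true] at h1
    rw [← h1]
    refine congrArg _ (filter_congr fun r hr => ?_)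
    obtain ⟨f, -, hf⟩ := mem_acyclicOrientations.1 hr
    rw [and_true]
    refine ⟨fun h a ha b _ => h a ha b, fun h' a ha b hab => ?_⟩
    have h3 := (hf a b).1 hab
    exact h' a ha b (mem_sdiff.2 ⟨h3.2.1, fun hb => h a ha b hb h3.2.2.1⟩) hab
  · push Not at h
    obtain ⟨a, ha, b, hb, hab⟩ := h
    rw [card_eq_zero, eq_empty_iff_forall_notMem]
    intro r hr
    rw [mem_filter, mem_acyclicOrientations] at hr
    obtain ⟨⟨f, hf, hrf⟩, hs⟩ := hr
    rcases (hf a (hI ha) b (hI hb) hab).lt_or_gt with h | h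
    · exact hs a ha b ((hrf a b).2 ⟨hI ha, hI hb, hab, h⟩)
    · exact hs b hb a ((hrf b a).2 ⟨hI hb, hI ha, hab.symm, h⟩)

theorem sum_sinks_eq_zero {T : Finset V} (hT : T.Nonempty) :
    ∑ I ∈ T.powerset, (-1 : ℝ) ^ #I *
      (if ∀ a ∈ I, ∀ b ∈ I, ¬ G.Adj a b then (#(G.acyclicOrientations (T \ I)) : ℝ) else 0) =
      0 := by
  have h1 : ∀ I ∈ T.powerset, (-1 : ℝ) ^ #I *
      (if ∀ a ∈ I, ∀ b ∈ I, ¬ G.Adj a b then (#(G.acyclicOrientations (T \ I)) : ℝ) else 0) =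
      ∑ r ∈ G.acyclicOrientations T, if ∀ a ∈ I, ∀ b, ¬ r a b then (-1 : ℝ) ^ #I else 0 := by
    intro I hI
    rw [← sum_filter, sum_const, card_acyclicOrientations_sinks (mem_powerset.1 hI)]
    split_ifs <;> simp [mul_comm]
  rw [sum_congr rfl h1, sum_comm]
  refine sum_eq_zero fun r hr => ?_
  have h2 : {I ∈ T.powerset | ∀ a ∈ I, ∀ b, ¬ r a b} = {a ∈ T | ∀ b, ¬ r a b}.powerset := by
    ext I
    simp only [mem_filter, mem_powerset, Finset.subset_iff]
    grind
  rw [← sum_filter, h2]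
  have h3 : {a ∈ T | ∀ b, ¬ r a b}.Nonempty := by
    obtain ⟨f, -, hf⟩ := mem_acyclicOrientations.1 hr
    obtain ⟨w, hw, hmax⟩ := exists_max_image T f hT
    refine ⟨w, mem_filter.2 ⟨hw, fun b hb => ?_⟩⟩
    have h4 := (hf w b).1 hb
    exact absurd (hmax b h4.2.1) (by omega)
  exact_mod_cast sum_powerset_neg_one_pow_card_of_nonempty h3

/-! ### The chromatic polynomial at `-1` in terms of acyclic orientations -/

theorem neg_one_pow_card_sdiff {α : Type*} {S T : Finset α} (h : S ⊆ T) :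
    (-1 : ℝ) ^ #T = (-1) ^ #S * (-1) ^ #(T \ S) := by
  rw [← pow_add, add_comm, card_sdiff_add_card_eq_card h]

/-- Stanley's theorem. -/
theorem neg_one_pow_mul_eval_chromPolyOn (T : Finset V) :
    (-1) ^ #T * (G.chromPolyOn T).eval (-1) = #(G.acyclicOrientations T) := by
  induction T using Finset.strongInduction with
  | _ T ih =>
    rcases T.eq_empty_or_nonempty with rfl | hT
    · rw [chromPolyOn_empty, card_acyclicOrientations_of_indep (by simp)]
      simp
    · have h1 : ∑ I ∈ T.powerset, (-1 : ℝ) ^ #I *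
          (if ∀ a ∈ I, ∀ b ∈ I, ¬ G.Adj a b then
            (-1) ^ #(T \ I) * (G.chromPolyOn (T \ I)).eval (-1) else 0) = 0 := by
        have h2 := congrArg (eval 1) (comp_chromPolyOn (G := G) T (-1))
        simp only [eval_comp, eval_add, eval_X, eval_C, eval_finsetSum, eval_mul,
          eval_one_chromPolyOn, add_neg_cancel, eval_zero_chromPolyOn hT] at h2
        have h3 := congrArg ((-1) ^ #T * ·) h2
        simp only [mul_zero, mul_sum] at h3
        refine Eq.trans ?_ h3.symm
        refine sum_congr rfl fun I hI => ?_
        rw [neg_one_pow_card_sdiff (mem_powerset.1 hI)]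
        split_ifs <;> ring
      have h2 := sum_sinks_eq_zero (G := G) hT
      rw [← add_sum_erase _ _ (empty_mem_powerset T)] at h1 h2
      have h3 : ∀ I ∈ T.powerset.erase ∅,
          (-1) ^ #(T \ I) * (G.chromPolyOn (T \ I)).eval (-1) =
            #(G.acyclicOrientations (T \ I)) := fun I hI => by
        rw [mem_erase, mem_powerset, ← nonempty_iff_ne_empty] at hI
        exact ih _ (sdiff_ssubset hI.2 hI.1)
      rw [sum_congr rfl fun I hI => by rw [h3 I hI]] at h1
      simp only [card_empty, pow_zero, notMem_empty, IsEmpty.forall_iff, implies_true, if_true,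
        one_mul, sdiff_empty] at h1 h2
      linarith

/-- Greene and Zaslavsky's theorem: the linear coefficient of the chromatic polynomial counts
acyclic orientations such that `v` can be reached from everywhere. -/
theorem neg_one_pow_mul_eval_derivative_chromPolyOn {v : V} {T : Finset V} (hv : v ∈ T) :
    (-1) ^ (#T + 1) * (derivative (G.chromPolyOn T)).eval 0 =
      #{r ∈ G.acyclicOrientations T | ancestors r v = T} := by
  induction T using Finset.strongInduction with
  | _ T ih =>
    have h1 := eval_chromPolyOn_eq_mul_sum (G := G) hv (-1)
    have h2 : (#(G.acyclicOrientations T) : ℝ) = ∑ S ∈ T.powerset with v ∈ S,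
        ((-1) ^ (#S + 1) * (derivative (G.chromPolyOn S)).eval 0) *
          #(G.acyclicOrientations (T \ S)) := by
      rw [← neg_one_pow_mul_eval_chromPolyOn, h1, mul_sum, mul_sum]
      refine sum_congr rfl fun S hS => ?_
      rw [mem_filter, mem_powerset] at hS
      rw [← neg_one_pow_mul_eval_chromPolyOn, neg_one_pow_card_sdiff hS.1]
      ring
    have h3 := congrArg (Nat.cast (R := ℝ)) (card_acyclicOrientations_eq_sum (G := G) hv)
    rw [h2] at h3
    push_cast at h3
    have hT : T ∈ T.powerset.filter (v ∈ ·) := by simp [hv]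
    rw [← add_sum_erase _ _ hT, ← add_sum_erase _ _ hT] at h3
    have h4 : #(G.acyclicOrientations (T \ T)) = 1 :=
      card_acyclicOrientations_of_indep (by simp)
    have h5 : ∀ S ∈ (T.powerset.filter (v ∈ ·)).erase T,
        (-1) ^ (#S + 1) * (derivative (G.chromPolyOn S)).eval 0 =
          #{r ∈ G.acyclicOrientations S | ancestors r v = S} := fun S hS => by
      rw [mem_erase, mem_filter, mem_powerset] at hS
      exact ih S (hS.2.1.ssubset_of_ne hS.1) hS.2.2
    rw [sum_congr rfl fun S hS => by rw [h5 S hS], h4] at h3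
    simpa using h3

theorem neg_one_pow_mul_eval_neg_one_derivative_chromPolyOn (T : Finset V) :
    (-1) ^ (#T + 1) * (derivative (G.chromPolyOn T)).eval (-1) =
      ∑ r ∈ G.acyclicOrientations T, ∑ v ∈ T, (1 : ℝ) / #(ancestors r v) := by
  have h1 : ∀ v ∈ T, ∑ r ∈ G.acyclicOrientations T, (1 : ℝ) / #(ancestors r v) =
      ∑ S ∈ T.powerset, if v ∈ S then (1 : ℝ) / #S *
        ((-1) ^ (#S + 1) * (derivative (G.chromPolyOn S)).eval 0 *
          #(G.acyclicOrientations (T \ S))) else 0 := by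
    intro v hv
    rw [← sum_filter, ← sum_fiberwise_of_maps_to fun r hr => ancestors_mem_powerset hr hv]
    refine sum_congr rfl fun S hS => ?_
    rw [mem_filter, mem_powerset] at hS
    rw [neg_one_pow_mul_eval_derivative_chromPolyOn hS.2, ← Nat.cast_mul,
      ← card_acyclicOrientations_ancestors_eq hS.1 hS.2,
      sum_congr rfl fun r hr => by rw [(mem_filter.1 hr).2], sum_const, nsmul_eq_mul, mul_comm]
  rw [sum_comm, sum_congr rfl h1, sum_comm, eval_derivative_chromPolyOn, mul_sum]
  refine sum_congr rfl fun S hS => ?_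
  rw [mem_powerset] at hS
  rw [← sum_filter, filter_mem_eq_inter, inter_eq_right.2 hS, sum_const, nsmul_eq_mul]
  rcases S.eq_empty_or_nonempty with rfl | hne
  · simp [chromPolyOn_empty]
  · have : (#S : ℝ) ≠ 0 := by exact_mod_cast hne.card_pos.ne'
    rw [← neg_one_pow_mul_eval_chromPolyOn, pow_succ, neg_one_pow_card_sdiff hS]
    field_simp
    ring

/-! ### The upper bound -/

theorem harmonic_le_sum_one_div_ancestors {r : V → V → Prop} {f : V → ℕ}
    (hf : ∀ a b, r a b → f a < f b) {T : Finset V} (hT : ∀ a, ∀ b ∈ T, r a b → a ∈ T) :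
    ∑ k ∈ Icc 1 #T, (1 : ℝ) / k ≤ ∑ v ∈ T, (1 : ℝ) / #(ancestors r v) := by
  induction hn : #T generalizing T with
  | zero => simp [card_eq_zero.1 hn]
  | succ n ih =>
    obtain ⟨w, hw, hmax⟩ := exists_max_image T f (card_pos.1 (by omega))
    have h1 := ih (T := T.erase w) (fun a b hb hab => by
      rw [mem_erase] at hb ⊢
      refine ⟨?_, hT a b hb.2 hab⟩
      rintro rfl
      exact (hf _ _ hab).not_ge (hmax b hb.2)) (by rw [card_erase_of_mem hw, hn]; rfl)
    rw [sum_Icc_succ_top (by omega), ← sum_erase_add _ _ hw]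
    refine add_le_add h1 (one_div_le_one_div_of_le ?_ ?_)
    · exact_mod_cast card_pos.2 ⟨w, self_mem_ancestors r w⟩
    · rw [← hn]
      exact_mod_cast card_le_card (ancestors_subset hw hT)

/-- If `u` is a sink that is not reachable from `v`, the harmonic bound is strict. -/
theorem harmonic_lt_sum_one_div_ancestors {r : V → V → Prop} {f : V → ℕ}
    (hf : ∀ a b, r a b → f a < f b) {u v : V} (hu : ∀ b, ¬ r u b) (hv : v ∉ ancestors r u) :
    ∑ k ∈ Icc 1 (Fintype.card V), (1 : ℝ) / k < ∑ x, (1 : ℝ) / #(ancestors r x) := by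
  obtain ⟨n, hn⟩ : ∃ n, Fintype.card V = n + 1 :=
    Nat.exists_eq_succ_of_ne_zero (Fintype.card_pos_iff.2 ⟨u⟩).ne'
  have h1 := harmonic_le_sum_one_div_ancestors hf (T := univ.erase u) fun a b _ hab => by
    refine mem_erase.2 ⟨?_, mem_univ a⟩
    rintro rfl
    exact hu b hab
  have hcard : #(univ.erase u) = n := by
    rw [card_erase_of_mem (mem_univ u), card_univ, hn]
    rfl
  have h2 : #(ancestors r u) < n + 1 := by
    rw [← hn, ← card_univ]
    exact card_lt_card (ssubset_univ_iff.2 fun h => hv (h ▸ mem_univ v))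
  rw [hcard] at h1
  rw [hn, sum_Icc_succ_top (by omega), ← sum_erase_add _ _ (mem_univ u)]
  refine add_lt_add_of_le_of_lt h1 (one_div_lt_one_div_of_lt ?_ ?_)
  · exact_mod_cast card_pos.2 ⟨u, self_mem_ancestors r u⟩
  · exact_mod_cast h2

theorem harmonic_mul_eval_chromPolyOn_lt (hG : G ≠ ⊤) :
    (∑ k ∈ Icc 1 (Fintype.card V), (1 : ℝ) / k) *
        ((-1) ^ Fintype.card V * (G.chromPolyOn univ).eval (-1)) <
      (-1) ^ (Fintype.card V + 1) * (derivative (G.chromPolyOn univ)).eval (-1) := by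
  rw [← card_univ, neg_one_pow_mul_eval_chromPolyOn,
    neg_one_pow_mul_eval_neg_one_derivative_chromPolyOn, mul_comm, ← nsmul_eq_mul, ← sum_const,
    card_univ]
  refine sum_lt_sum (fun r hr => ?_) ?_
  · obtain ⟨f, -, hf⟩ := mem_acyclicOrientations.1 hr
    rw [← card_univ]
    exact harmonic_le_sum_one_div_ancestors (fun a b h => ((hf a b).1 h).2.2.2)
      fun a _ _ _ => mem_univ a
  · obtain ⟨u, v, huv, hadj⟩ := ne_top_iff_exists_not_adj.1 hG
    let e := Fintype.equivFin V
    let f : V → ℕ := fun x => if x = u ∨ x = v then Fintype.card V else e x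
    have hf : ∀ x, f x ≤ Fintype.card V := fun x => by
      have := (e x).2
      simp only [f]
      split_ifs <;> omega
    refine ⟨fun a b => G.Adj a b ∧ f a < f b,
      mem_acyclicOrientations.2 ⟨f, fun a _ b _ hab hab' => ?_, by simp⟩,
      harmonic_lt_sum_one_div_ancestors (u := u) (v := v) (f := f) (fun a b h => h.2)
        (fun b hb => ?_) fun hv => ?_⟩
    · have h1 := (e a).2
      have h2 := (e b).2
      have h3 : (e a : ℕ) = e b → a = b := fun h => e.injective (Fin.ext h)
      have h4 := hab.ne
      have h5 := hab.symm
      simp only [f] at hab'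
      grind
    · have : f u = Fintype.card V := by simp [f]
      exact (hf b).not_gt (this ▸ hb.2)
    · rcases (mem_ancestors.1 hv).cases_head with h | ⟨b, hb, -⟩
      · exact huv h.symm
      · have : f v = Fintype.card V := by simp [f]
        exact (hf b).not_gt (this ▸ hb.2)

end SimpleGraph

theorem stmt18 {V : Type*} [Fintype V] (G : SimpleGraph V)
    (hconn : G.Connected) (hnc : G ≠ ⊤) (hnt : ¬ G.IsAcyclic)
    (P : Polynomial ℝ) (hP : IsChromPoly G P) :
    ((Fintype.card V : ℝ) - 1) / 2 <
      (Fintype.card V : ℝ) + (Polynomial.derivative P).eval (-1) / P.eval (-1) ∧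
    (Fintype.card V : ℝ) + (Polynomial.derivative P).eval (-1) / P.eval (-1) <
      (Fintype.card V : ℝ) - ∑ k ∈ Finset.Icc 1 (Fintype.card V), (1 : ℝ) / k := by
  obtain ⟨hpos, -, hlow⟩ := hconn.chromPoly_lower_bound hP
  have hlow := hlow hnt
  have hup := SimpleGraph.harmonic_mul_eval_chromPolyOn_lt hnc
  rw [← hP.unique SimpleGraph.isChromPoly_chromPolyOn_univ] at hup
  have hratio : (derivative P).eval (-1) / P.eval (-1) =
      -(((-1) ^ (Fintype.card V + 1) * (derivative P).eval (-1)) /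
        ((-1) ^ Fintype.card V * P.eval (-1))) := by
    rw [pow_succ, mul_assoc, mul_div_mul_left _ _ (pow_ne_zero _ (by norm_num)), neg_one_mul,
      neg_div, neg_neg]
  rw [hratio]
  constructor
  · have := (div_lt_iff₀ hpos).2 (show (-1) ^ (Fintype.card V + 1) * (derivative P).eval (-1) <
      (Fintype.card V + 1 : ℝ) / 2 * ((-1) ^ Fintype.card V * P.eval (-1)) by linarith)
    linarith
  · have := (lt_div_iff₀ hpos).2 hup
    linarith
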